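/- arXiv:2404.03978 — 2 statements merged into one kernel-verified Lean document; each statement's English description precedes it below -/
import Mathlib

section
/- Let N ≥ 3 and write V(σ) = (V_x(σ), V_y(σ)) with V_x(σ) = Σ_{j=1}^{N} σ(j)·cos(2πj/N) and V_y(σ) = Σ_{j=1}^{N} σ(j)·sin(2πj/N). Then the second moments of the two coordinates under a uniformly random permutation σ of {1,...,N} are equal and satisfy (1/N!) · Σ_{σ ∈ S_N} V_x(σ)² = (1/N!) · Σ_{σ ∈ S_N} V_y(σ)² = N²(N+1)/24. -/
open Real

/-- The x-component of the RVG output: V_x(σ) = Σ_{j=1}^{N} σ(j)·cos(2πj/N),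
with {1,...,N} encoded via `Fin N`. -/
noncomputable def Vx (N : ℕ) (σ : Equiv.Perm (Fin N)) : ℝ :=
  ∑ j : Fin N, ((σ j : ℝ) + 1) * Real.cos (2 * Real.pi * ((j : ℝ) + 1) / N)

/-- The y-component of the RVG output: V_y(σ) = Σ_{j=1}^{N} σ(j)·sin(2πj/N),
with {1,...,N} encoded via `Fin N`. -/
noncomputable def Vy (N : ℕ) (σ : Equiv.Perm (Fin N)) : ℝ :=
  ∑ j : Fin N, ((σ j : ℝ) + 1) * Real.sin (2 * Real.pi * ((j : ℝ) + 1) / N)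

theorem perm_pair_sum (N : ℕ) (a : Fin N → ℝ) (τ : Equiv.Perm (Fin N)) (j k : Fin N) :
    ∑ σ : Equiv.Perm (Fin N), a (σ (τ j)) * a (σ (τ k)) =
      ∑ σ : Equiv.Perm (Fin N), a (σ j) * a (σ k) :=
  Equiv.sum_comp (Equiv.mulRight τ) (fun σ : Equiv.Perm (Fin N) => a (σ j) * a (σ k))

theorem exists_perm_pair {N : ℕ} {j k j' k' : Fin N} (h : j ≠ k) (h' : j' ≠ k') :
    ∃ τ : Equiv.Perm (Fin N), τ j = j' ∧ τ k = k' := by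
  refine ⟨Equiv.swap (Equiv.swap j j' k) k' * Equiv.swap j j', ?_, ?_⟩
  · have h1 : j' ≠ Equiv.swap j j' k := by
      intro e
      apply h
      apply (Equiv.swap j j').injective
      rw [← e, Equiv.swap_apply_left]
    rw [Equiv.Perm.mul_apply, Equiv.swap_apply_left, Equiv.swap_apply_of_ne_of_ne h1 h']
  · rw [Equiv.Perm.mul_apply, Equiv.swap_apply_left]

theorem perm_second_moment (N : ℕ) (hN : 2 ≤ N) (a c : Fin N → ℝ) (hc : ∑ j, c j = 0) :
    (N : ℝ) * (N - 1) * ∑ σ : Equiv.Perm (Fin N), (∑ j, a (σ j) * c j) ^ 2 =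
      (N.factorial : ℝ) * (N * ∑ j, a j ^ 2 - (∑ j, a j) ^ 2) * ∑ j, c j ^ 2 := by
  set E : Fin N → Fin N → ℝ := fun j k => ∑ σ : Equiv.Perm (Fin N), a (σ j) * a (σ k) with hE
  let i0 : Fin N := ⟨0, by omega⟩
  let i1 : Fin N := ⟨1, by omega⟩
  have h01 : i0 ≠ i1 := by simp [i0, i1]
  obtain ⟨P, hP⟩ : ∃ P, P = E i0 i0 := ⟨_, rfl⟩
  obtain ⟨Q, hQ⟩ : ∃ Q, Q = E i0 i1 := ⟨_, rfl⟩
  have hEv : ∀ j k, E j k = Q + (if j = k then P - Q else 0) := by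
    intro j k
    split_ifs with h
    · subst h
      have := perm_pair_sum N a (Equiv.swap i0 j) i0 i0
      rw [Equiv.swap_apply_left] at this
      rw [hP]
      linarith
    · obtain ⟨τ, h1, h2⟩ := exists_perm_pair h01 h
      have := perm_pair_sum N a τ i0 i1
      rw [h1, h2] at this
      rw [hQ]
      linarith
  have hexp : ∀ d : Fin N → ℝ, ∑ σ : Equiv.Perm (Fin N), (∑ j, a (σ j) * d j) ^ 2 =
      Q * (∑ j, d j) ^ 2 + (P - Q) * ∑ j, d j ^ 2 := by
    intro d
    have : ∑ σ : Equiv.Perm (Fin N), (∑ j, a (σ j) * d j) ^ 2 =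
        ∑ j, ∑ k, d j * d k * E j k := by
      simp only [sq, Finset.sum_mul_sum]
      simp only [hE, Finset.mul_sum]
      rw [Finset.sum_comm]
      refine Finset.sum_congr rfl fun j _ => ?_
      rw [Finset.sum_comm]
      refine Finset.sum_congr rfl fun k _ => Finset.sum_congr rfl fun σ _ => ?_
      ring
    rw [this]
    simp only [hEv, mul_add, Finset.sum_add_distrib, mul_ite, mul_zero, Finset.sum_ite_eq,
      Finset.mem_univ, if_true]
    rw [sq, Finset.sum_mul_sum, Finset.mul_sum, Finset.mul_sum]
    congr 1
    · refine Finset.sum_congr rfl fun j _ => ?_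
      rw [Finset.mul_sum]
      exact Finset.sum_congr rfl fun k _ => by ring
    · exact Finset.sum_congr rfl fun k _ => by ring
  have hcard : (Fintype.card (Equiv.Perm (Fin N)) : ℝ) = N.factorial := by
    rw [Fintype.card_perm, Fintype.card_fin]
  have e1 := hexp (fun _ => 1)
  simp only [mul_one, one_pow, Finset.sum_const, Finset.card_univ, Fintype.card_fin,
    nsmul_eq_mul, Equiv.sum_comp, hcard] at e1
  have e2 : (N : ℝ) * P = N.factorial * ∑ j, a j ^ 2 := by
    have : ∑ j, E j j = N.factorial * ∑ j, a j ^ 2 := by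
      simp only [hE]
      rw [Finset.sum_comm]
      have : ∀ σ : Equiv.Perm (Fin N), ∑ j, a (σ j) * a (σ j) = ∑ j, a j ^ 2 := fun σ => by
        rw [Equiv.sum_comp σ (fun j => a j * a j)]
        simp only [sq]
      simp only [this, Finset.sum_const, Finset.card_univ, nsmul_eq_mul, hcard]
    rw [← this]
    simp [hEv]
  rw [hexp c, hc]
  have e3 : (N : ℝ) * (N - 1) * (P - Q) =
      (N.factorial : ℝ) * (N * ∑ j, a j ^ 2 - (∑ j, a j) ^ 2) := by
    linear_combination (N : ℝ) * e2 + e1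
  rw [← e3]
  ring

theorem exp_sum_zero (N m : ℕ) (hm : 0 < m) (hmN : m < N) :
    ∑ j : Fin N, Complex.exp (((m * (2 * Real.pi * ((j : ℝ) + 1) / N) : ℝ) : ℂ) * Complex.I)
      = 0 := by
  have hN : N ≠ 0 := by omega
  have hN' : (N : ℂ) ≠ 0 := by exact_mod_cast hN
  have hp := Complex.isPrimitiveRoot_exp N hN
  set z := Complex.exp (2 * Real.pi * Complex.I / N) with hz
  have h1 : z ^ m ≠ 1 := hp.pow_ne_one_of_pos_of_lt hm.ne' hmN
  have h2 : ∀ j : Fin N,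
      Complex.exp (((m * (2 * Real.pi * ((j : ℝ) + 1) / N) : ℝ) : ℂ) * Complex.I)
        = z ^ m * (z ^ m) ^ (j : ℕ) := by
    intro j
    rw [← pow_succ', ← pow_mul, hz, ← Complex.exp_nat_mul]
    congr 1
    push_cast
    ring
  simp only [h2]
  rw [← Finset.mul_sum, Fin.sum_univ_eq_sum_range (fun j => (z ^ m) ^ j), geom_sum_eq h1,
    ← pow_mul, mul_comm m N, pow_mul, hp.pow_eq_one]
  simp

theorem cos_sum_zero (N m : ℕ) (hm : 0 < m) (hmN : m < N) :
    ∑ j : Fin N, Real.cos (m * (2 * Real.pi * ((j : ℝ) + 1) / N)) = 0 := by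
  have := congrArg Complex.re (exp_sum_zero N m hm hmN)
  simpa only [Complex.re_sum, Complex.exp_ofReal_mul_I_re, Complex.zero_re] using this

theorem sin_sum_zero (N m : ℕ) (hm : 0 < m) (hmN : m < N) :
    ∑ j : Fin N, Real.sin (m * (2 * Real.pi * ((j : ℝ) + 1) / N)) = 0 := by
  have := congrArg Complex.im (exp_sum_zero N m hm hmN)
  simpa only [Complex.im_sum, Complex.exp_ofReal_mul_I_im, Complex.zero_im] using this

theorem sum_lin (N : ℕ) : ∑ j : Fin N, ((j : ℝ) + 1) = (N : ℝ) * (N + 1) / 2 := by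
  rw [Fin.sum_univ_eq_sum_range (fun j => (j : ℝ) + 1)]
  induction N with
  | zero => simp
  | succ n ih => rw [Finset.sum_range_succ, ih]; push_cast; ring

theorem sum_quad (N : ℕ) :
    ∑ j : Fin N, ((j : ℝ) + 1) ^ 2 = (N : ℝ) * (N + 1) * (2 * N + 1) / 6 := by
  rw [Fin.sum_univ_eq_sum_range (fun j => ((j : ℝ) + 1) ^ 2)]
  induction N with
  | zero => simp
  | succ n ih => rw [Finset.sum_range_succ, ih]; push_cast; ring

theorem moment_aux (N : ℕ) (hN : 3 ≤ N) (c : Fin N → ℝ) (hc : ∑ j, c j = 0)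
    (hc2 : ∑ j, c j ^ 2 = N / 2) :
    (1 / (N.factorial : ℝ)) * ∑ σ : Equiv.Perm (Fin N), (∑ j, ((σ j : ℝ) + 1) * c j) ^ 2 =
        (N : ℝ) ^ 2 * ((N : ℝ) + 1) / 24 := by
  have h := perm_second_moment N (by omega) (fun j => (j : ℝ) + 1) c hc
  simp only [hc2, sum_lin, sum_quad] at h
  have hf : (N.factorial : ℝ) ≠ 0 := by exact_mod_cast N.factorial_ne_zero
  have hN3 : (3 : ℝ) ≤ N := by exact_mod_cast hN
  have h0 : (N : ℝ) * (N - 1) ≠ 0 := by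
    apply ne_of_gt
    apply mul_pos <;> linarith
  rw [one_div, inv_mul_eq_iff_eq_mul₀ hf]
  apply mul_left_cancel₀ h0
  rw [h]
  ring

/-- For N ≥ 3, the second moments of the two coordinates of V under a uniformly random
permutation σ of {1,...,N} are equal and both equal N²(N+1)/24. -/
theorem second_moments_components (N : ℕ) (hN : 3 ≤ N) :
    (1 / (N.factorial : ℝ)) * ∑ σ : Equiv.Perm (Fin N), Vx N σ ^ 2 =
        (N : ℝ) ^ 2 * ((N : ℝ) + 1) / 24 ∧
    (1 / (N.factorial : ℝ)) * ∑ σ : Equiv.Perm (Fin N), Vy N σ ^ 2 =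
        (N : ℝ) ^ 2 * ((N : ℝ) + 1) / 24 := by
  have hc := cos_sum_zero N 1 (by omega) (by omega)
  have hs := sin_sum_zero N 1 (by omega) (by omega)
  have h2 := cos_sum_zero N 2 (by omega) (by omega)
  simp only [Nat.cast_one, one_mul] at hc hs
  have hcc : ∑ j : Fin N, Real.cos (2 * Real.pi * ((j : ℝ) + 1) / N) ^ 2 = N / 2 := by
    simp only [Nat.cast_ofNat, Real.cos_two_mul, Finset.sum_sub_distrib, ← Finset.mul_sum,
      Finset.sum_const, Finset.card_univ, Fintype.card_fin, nsmul_eq_mul, mul_one] at h2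
    linarith
  have hss : ∑ j : Fin N, Real.sin (2 * Real.pi * ((j : ℝ) + 1) / N) ^ 2 = N / 2 := by
    simp only [Real.sin_sq, Finset.sum_sub_distrib, hcc,
      Finset.sum_const, Finset.card_univ, Fintype.card_fin, nsmul_eq_mul, mul_one]
    ring
  exact ⟨moment_aux N hN _ hc hcc, moment_aux N hN _ hs hss⟩
end

section
/- Define the permutation distribution P_Per(n|N) = P(N,n) / (F(N) − 1) for 1 ≤ n ≤ N. Then lim_{N→∞} Σ_{k=0}^{5} P_Per(N−k | N) = 163/(60e); that is, asymptotically the six longest sequence lengths carry total probability 163/(60e) ≈ 0.99941. -/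
/-- P(n,i) = n!/(n−i)!, the number of i-permutations of n (the division is exact for i ≤ n). -/
def P (n i : ℕ) : ℕ := n.factorial / (n - i).factorial

/-- F(N) = Σ_{j=0}^{N} P(N,j), the total number of permutation events over N elements. -/
def F (N : ℕ) : ℕ := ∑ j ∈ Finset.range (N + 1), P N j

/-- The permutation distribution: P_Per(n|N) = P(N,n) / (F(N) − 1). -/
noncomputable def P_Per (n N : ℕ) : ℝ := (P N n : ℝ) / ((F N - 1 : ℕ) : ℝ)

lemma P_cast (N j : ℕ) : (P N j : ℝ) = (N.factorial : ℝ) / ((N - j).factorial : ℝ) := by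
  unfold P
  rw [Nat.cast_div (Nat.factorial_dvd_factorial (Nat.sub_le _ _))]
  exact_mod_cast Nat.factorial_ne_zero _

lemma F_cast (N : ℕ) :
    (F N : ℝ) = N.factorial * ∑ k ∈ Finset.range (N + 1), 1 / (k.factorial : ℝ) := by
  unfold F
  push_cast
  rw [← Finset.sum_range_reflect (fun k : ℕ => 1 / (k.factorial : ℝ)), Finset.mul_sum]
  refine Finset.sum_congr rfl fun j _ => ?_
  rw [P_cast, Nat.add_sub_cancel, mul_one_div]

lemma one_le_F (N : ℕ) : 1 ≤ F N := by
  have h : P N 0 ≤ F N :=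
    Finset.single_le_sum (f := fun j => P N j) (fun _ _ => Nat.zero_le _) (by simp)
  have h0 : P N 0 = 1 := by
    simp [P, Nat.div_self (Nat.factorial_pos N)]
  omega

lemma P_Per_sub (N k : ℕ) (hk : k ≤ N) :
    P_Per (N - k) N = (1 / (k.factorial : ℝ)) /
      ((∑ k ∈ Finset.range (N + 1), 1 / (k.factorial : ℝ)) - 1 / (N.factorial : ℝ)) := by
  have hN : (N.factorial : ℝ) ≠ 0 := by exact_mod_cast Nat.factorial_ne_zero _
  unfold P_Per
  rw [P_cast, Nat.sub_sub_self hk, Nat.cast_sub (one_le_F N), F_cast, Nat.cast_one,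
    ← mul_div_mul_left (1 / (k.factorial : ℝ)) _ hN, mul_sub, mul_one_div_cancel hN, mul_one_div]

/-- Asymptotically, the six longest sequence lengths carry total probability 163/(60e):
lim_{N→∞} Σ_{k=0}^{5} P_Per(N−k | N) = 163/(60e). -/
theorem limit_sum_P_Per_last_six :
    Filter.Tendsto (fun N : ℕ => ∑ k ∈ Finset.range 6, P_Per (N - k) N) Filter.atTop
      (nhds (163 / (60 * Real.exp 1))) := by
  have hS : Filter.Tendsto (fun N : ℕ => ∑ k ∈ Finset.range (N + 1), 1 / (k.factorial : ℝ))
      Filter.atTop (nhds (Real.exp 1)) := by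
    have h := NormedSpace.expSeries_div_hasSum_exp (1 : ℝ)
    rw [← Real.exp_eq_exp_ℝ] at h
    simp only [one_pow] at h
    exact h.tendsto_sum_nat.comp (Filter.tendsto_add_atTop_nat 1)
  have hI : Filter.Tendsto (fun N : ℕ => 1 / (N.factorial : ℝ)) Filter.atTop (nhds 0) := by
    simpa using FloorSemiring.tendsto_pow_div_factorial_atTop (1 : ℝ)
  have hD := hS.sub hI
  rw [sub_zero] at hD
  have hT := (tendsto_const_nhds (x := (163 / 60 : ℝ))).div hD (Real.exp_pos 1).ne'
  rw [div_div] at hT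
  refine hT.congr' ?_
  filter_upwards [Filter.eventually_ge_atTop 5] with N hN
  have h6 : ∑ k ∈ Finset.range 6, 1 / (k.factorial : ℝ) = 163 / 60 := by
    simp [Finset.sum_range_succ, Nat.factorial]
    norm_num
  rw [Finset.sum_congr rfl fun k hk =>
    P_Per_sub N k (by have := Finset.mem_range.mp hk; omega), ← Finset.sum_div, h6]
  rfl
end
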